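/- In the configuration Γ^D, the space Ḣ^{1/2}(Γ^D) modulo constants is complete: if (f_n) is a sequence of measurable functions on Γ^D, each integrable on every bounded measurable subset of Γ^D with |f_n|_{Ḣ^{1/2}(Γ^D)} < ∞, and |f_n − f_m|_{Ḣ^{1/2}(Γ^D)} → 0 as n, m → ∞, then there exists a measurable f on Γ^D, integrable on every bounded measurable subset of Γ^D with |f|_{Ḣ^{1/2}(Γ^D)} < ∞, such that |f_n − f|_{Ḣ^{1/2}(Γ^D)} → 0 as n → ∞. (Note that the seminorm |·|_{Ḣ^{1/2}(Γ^D)} is invariant under adding a single global constant, so this is exactly completeness of the quotient Ḣ^{1/2}(Γ^D)/ℝ.) -/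

import Mathlib

open MeasureTheory Set Filter
open scoped ENNReal BigOperators

noncomputable def screenedSeminorm (I : Set ℝ) (r : ℝ) (f : ℝ → ℝ) : ℝ≥0∞ :=
  (∫⁻ x in I, ∫⁻ y in I ∩ Set.Ioo (x - r) (x + r),
      ENNReal.ofReal ((f y - f x) ^ 2 / (y - x) ^ 2)) ^ (1 / 2 : ℝ)

def LocIntOn (I : Set ℝ) (f : ℝ → ℝ) : Prop :=
  ∀ s : Set ℝ, s ⊆ I → MeasurableSet s → Bornology.IsBounded s →
    MeasureTheory.IntegrableOn f s

noncomputable def avgOn (J : Set ℝ) (f : ℝ → ℝ) : ℝ :=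
  (MeasureTheory.volume J).toReal⁻¹ * ∫ x in J, f x

/-- The configuration `Γ^D`: `N + 1` nonempty open intervals `E 0, …, E N` listed in
increasing order and separated by gaps of positive length, all bounded except that `E 0`
may be a half-line unbounded to the left and `E N` a half-line unbounded to the right,
together with bounded averaging windows `I j ⊆ E j` (with `I j = E j` when `E j` is bounded). -/
structure GammaConfig (N : ℕ) where
  hN : 1 ≤ N
  E : Fin (N + 1) → Set ℝ
  I : Fin (N + 1) → Set ℝ
  hE : ∀ j, (∃ a b : ℝ, a < b ∧ E j = Set.Ioo a b) ∨
      (j = 0 ∧ ∃ b : ℝ, E j = Set.Iio b) ∨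
      (j = Fin.last N ∧ ∃ a : ℝ, E j = Set.Ioi a)
  hsep : ∀ j : Fin N, ∃ c d : ℝ, c < d ∧ (∀ x ∈ E j.castSucc, x ≤ c) ∧ ∀ y ∈ E j.succ, d ≤ y
  hIsub : ∀ j, I j ⊆ E j
  hIint : ∀ j, ∃ a b : ℝ, a < b ∧ I j = Set.Ioo a b
  hIeq : ∀ j, Bornology.IsBounded (E j) → I j = E j

/-- The union `Γ^D = ⋃ j, E j`. -/
def GammaConfig.Gamma {N : ℕ} (cfg : GammaConfig N) : Set ℝ := ⋃ j, cfg.E j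

/-- The seminorm `|f|_{Ḣ^{1/2}(Γ^D)}`, including the nonlocal terms linking the
connected components. -/
noncomputable def GammaConfig.seminorm {N : ℕ} (cfg : GammaConfig N) (f : ℝ → ℝ) : ℝ≥0∞ :=
  (∑ j : Fin (N + 1), screenedSeminorm (cfg.E j) 1 f) +
    ∑ j : Fin N, ENNReal.ofReal |avgOn (cfg.I j.succ) f - avgOn (cfg.I j.castSucc) f|

/-- The integrand of the squared screened seminorm, extended by zero off the screening strip. -/
noncomputable def screenedKernel (r : ℝ) (h : ℝ → ℝ) : ℝ × ℝ → ℝ≥0∞ :=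
  {p : ℝ × ℝ | p.2 ∈ Ioo (p.1 - r) (p.1 + r)}.indicator
    fun p => ENNReal.ofReal ((h p.2 - h p.1) ^ 2 / (p.2 - p.1) ^ 2)

lemma measurableSet_strip (r : ℝ) :
    MeasurableSet {p : ℝ × ℝ | p.2 ∈ Ioo (p.1 - r) (p.1 + r)} :=
  (measurableSet_lt (f := fun p : ℝ × ℝ => p.1 - r) (by fun_prop) measurable_snd).inter
    (measurableSet_lt (g := fun p : ℝ × ℝ => p.1 + r) measurable_snd (by fun_prop))

lemma measurable_screenedKernel (r : ℝ) {h : ℝ → ℝ} (hh : Measurable h) :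
    Measurable (screenedKernel r h) :=
  Measurable.indicator (by fun_prop) (measurableSet_strip r)

lemma setLIntegral_screenedKernel (I : Set ℝ) (r : ℝ) (h : ℝ → ℝ) (x : ℝ) :
    ∫⁻ y in I, screenedKernel r h (x, y) =
      ∫⁻ y in I ∩ Ioo (x - r) (x + r), ENNReal.ofReal ((h y - h x) ^ 2 / (y - x) ^ 2) := by
  rw [inter_comm, ← setLIntegral_indicator measurableSet_Ioo]
  rfl

lemma screenedSeminorm_eq_lintegral_prod (I : Set ℝ) (r : ℝ) {h : ℝ → ℝ} (hh : Measurable h) :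
    screenedSeminorm I r h =
      (∫⁻ p, screenedKernel r h p
        ∂((volume.restrict I).prod (volume.restrict I))) ^ (1 / 2 : ℝ) := by
  rw [lintegral_prod _ (measurable_screenedKernel r hh).aemeasurable, screenedSeminorm]
  simp_rw [setLIntegral_screenedKernel]

lemma screenedSeminorm_le_iff (I : Set ℝ) (r : ℝ) {h : ℝ → ℝ} (hh : Measurable h) (c : ℝ≥0∞) :
    screenedSeminorm I r h ≤ c ↔
      ∫⁻ p, screenedKernel r h p ∂((volume.restrict I).prod (volume.restrict I)) ≤ c ^ 2 := by
  rw [screenedSeminorm_eq_lintegral_prod I r hh, one_div, ENNReal.rpow_inv_le_iff two_pos,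
    ENNReal.rpow_two]

lemma tendsto_screenedKernel (r : ℝ) {h : ℕ → ℝ → ℝ} {g : ℝ → ℝ} {p : ℝ × ℝ}
    (h₁ : Tendsto (fun n => h n p.1) atTop (nhds (g p.1)))
    (h₂ : Tendsto (fun n => h n p.2) atTop (nhds (g p.2))) :
    Tendsto (fun n => screenedKernel r (h n) p) atTop (nhds (screenedKernel r g p)) := by
  by_cases hp : p ∈ {p : ℝ × ℝ | p.2 ∈ Ioo (p.1 - r) (p.1 + r)}
  · simp only [screenedKernel, indicator_of_mem hp]
    exact ENNReal.tendsto_ofReal (((h₂.sub h₁).pow 2).div_const _)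
  · simp only [screenedKernel, indicator_of_notMem hp]
    exact tendsto_const_nhds

/-- Lower semicontinuity of the screened seminorm under almost everywhere convergence. -/
lemma screenedSeminorm_le_of_tendsto_ae {I : Set ℝ} {r : ℝ} {h : ℕ → ℝ → ℝ} {g : ℝ → ℝ}
    (hh : ∀ n, Measurable (h n)) (hg : Measurable g)
    (hlim : ∀ᵐ x ∂volume.restrict I, Tendsto (fun n => h n x) atTop (nhds (g x)))
    {c : ℝ≥0∞} (hc : ∀ᶠ n in atTop, screenedSeminorm I r (h n) ≤ c) :
    screenedSeminorm I r g ≤ c := by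
  rw [screenedSeminorm_le_iff I r hg]
  set π := (volume.restrict I).prod (volume.restrict I)
  calc ∫⁻ p, screenedKernel r g p ∂π
      = ∫⁻ p, liminf (fun n => screenedKernel r (h n) p) atTop ∂π := by
        refine lintegral_congr_ae ?_
        filter_upwards [Measure.quasiMeasurePreserving_fst.ae hlim,
          Measure.quasiMeasurePreserving_snd.ae hlim] with p h₁ h₂
        exact (tendsto_screenedKernel r h₁ h₂).liminf_eq.symm
    _ ≤ liminf (fun n => ∫⁻ p, screenedKernel r (h n) p ∂π) atTop :=
        lintegral_liminf_le fun n => measurable_screenedKernel r (hh n)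
    _ ≤ c ^ 2 := liminf_le_of_frequently_le'
        (hc.mono fun n hn => (screenedSeminorm_le_iff I r (hh n) c).1 hn).frequently

lemma screenedSeminorm_congr_ae {I : Set ℝ} {r : ℝ} {f g : ℝ → ℝ}
    (hfg : f =ᵐ[volume.restrict I] g) : screenedSeminorm I r f = screenedSeminorm I r g := by
  unfold screenedSeminorm
  congr 1
  refine lintegral_congr_ae ?_
  filter_upwards [hfg] with x hx
  refine lintegral_congr_ae ?_
  filter_upwards [ae_restrict_of_ae_restrict_of_subset inter_subset_left hfg] with y hy
  rw [hx, hy]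

lemma screenedSeminorm_sub_const (I : Set ℝ) (r : ℝ) (h : ℝ → ℝ) (c : ℝ) :
    screenedSeminorm I r (fun x => h x - c) = screenedSeminorm I r h := by
  simp only [screenedSeminorm, sub_sub_sub_cancel_right]

lemma screenedKernel_le_two_mul (r : ℝ) (f g : ℝ → ℝ) (p : ℝ × ℝ) :
    screenedKernel r g p ≤
      2 * (screenedKernel r f p + screenedKernel r (fun x => f x - g x) p) := by
  by_cases hp : p ∈ {p : ℝ × ℝ | p.2 ∈ Ioo (p.1 - r) (p.1 + r)}
  · simp only [screenedKernel, indicator_of_mem hp]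
    rw [← ENNReal.ofReal_add (by positivity) (by positivity), ← ENNReal.ofReal_ofNat,
      ← ENNReal.ofReal_mul zero_le_two, ← add_div, ← mul_div_assoc]
    refine ENNReal.ofReal_le_ofReal (div_le_div_of_nonneg_right ?_ (sq_nonneg _))
    nlinarith [sq_nonneg (2 * (f p.2 - f p.1) - (g p.2 - g p.1))]
  · simp only [screenedKernel, indicator_of_notMem hp, zero_le]

lemma screenedSeminorm_lt_top_of_sub {I : Set ℝ} {r : ℝ} {f g : ℝ → ℝ} (hf : Measurable f)
    (hg : Measurable g) (hf' : screenedSeminorm I r f < ⊤)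
    (hfg : screenedSeminorm I r (fun x => f x - g x) < ⊤) : screenedSeminorm I r g < ⊤ := by
  have hd : Measurable fun x => f x - g x := hf.sub hg
  rw [screenedSeminorm_eq_lintegral_prod I r hf, ENNReal.rpow_lt_top_iff_of_pos (by norm_num)]
    at hf'
  rw [screenedSeminorm_eq_lintegral_prod I r hd, ENNReal.rpow_lt_top_iff_of_pos (by norm_num)]
    at hfg
  rw [screenedSeminorm_eq_lintegral_prod I r hg, ENNReal.rpow_lt_top_iff_of_pos (by norm_num)]
  refine (lintegral_mono (screenedKernel_le_two_mul r f g)).trans_lt ?_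
  rw [lintegral_const_mul' _ _ ENNReal.ofNat_ne_top,
    lintegral_add_left (measurable_screenedKernel r hf)]
  exact ENNReal.mul_lt_top ENNReal.ofNat_lt_top (ENNReal.add_lt_top.2 ⟨hf', hfg⟩)

lemma enorm_sub_sq_le_screenedKernel (h : ℝ → ℝ) {x y : ℝ} (hxy : y ∈ Ioo (x - 1) (x + 1)) :
    ‖h y - h x‖ₑ ^ 2 ≤ screenedKernel 1 h (x, y) := by
  have hp : (x, y) ∈ {p : ℝ × ℝ | p.2 ∈ Ioo (p.1 - 1) (p.1 + 1)} := hxy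
  rw [screenedKernel, indicator_of_mem hp, ← ofReal_norm,
    ← ENNReal.ofReal_pow (norm_nonneg _), Real.norm_eq_abs, sq_abs]
  refine ENNReal.ofReal_le_ofReal ?_
  rcases eq_or_ne y x with rfl | hne
  · simp
  · rw [le_div_iff₀ (by have := sub_ne_zero.2 hne; positivity)]
    refine mul_le_of_le_one_right (sq_nonneg _) ?_
    rw [sq_le_one_iff_abs_le_one, abs_le]
    constructor <;> linarith [hxy.1, hxy.2]

/-- Poincaré inequality on an interval of length at most the screening radius. -/
lemma exists_const_lintegral_le_of_length_le_one {E : Set ℝ} {a b : ℝ} (hab : a < b)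
    (hlen : b - a ≤ 1) (hE : Ioo a b ⊆ E) {h : ℝ → ℝ} (hh : Measurable h) :
    ∃ c : ℝ, ∫⁻ x in Ioo a b, ‖h x - c‖ₑ ≤ screenedSeminorm E 1 h := by
  set J := Ioo a b with hJ
  have hJ0 : volume J ≠ 0 := by simp [hJ, hab]
  have hJtop : volume J ≠ ⊤ := by simp [hJ]
  set G : ℝ → ℝ≥0∞ := fun x => ∫⁻ y in J, screenedKernel 1 h (x, y)
  have hG : Measurable G := (measurable_screenedKernel 1 hh).lintegral_prod_right'
  obtain ⟨x, hxJ, hx⟩ := exists_le_setLAverage hJ0 hJtop hG.aemeasurable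
  refine ⟨h x, ?_⟩
  have hsub : ∫⁻ z in J, G z ≤ ∫⁻ z in E, ∫⁻ y in E, screenedKernel 1 h (z, y) :=
    (lintegral_mono fun z => lintegral_mono_set hE).trans (lintegral_mono_set hE)
  have hsq : (∫⁻ y in J, ‖h y - h x‖ₑ ^ (2 : ℝ)) ≤ G x := by
    refine setLIntegral_mono' measurableSet_Ioo fun y hy => ?_
    rw [ENNReal.rpow_two]
    exact enorm_sub_sq_le_screenedKernel h
      ⟨by linarith [hy.1, hxJ.2], by linarith [hy.2, hxJ.1]⟩
  have hhold := ENNReal.lintegral_mul_le_Lp_mul_Lq (volume.restrict J)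
    (p := 2) (q := 2) (Real.holderConjugate_iff.2 ⟨by norm_num, by norm_num⟩)
    (f := fun y => ‖h y - h x‖ₑ) (g := fun _ => 1) (by fun_prop) (by fun_prop)
  simp only [Pi.mul_apply, mul_one, ENNReal.one_rpow, lintegral_const, one_mul,
    Measure.restrict_apply_univ] at hhold
  refine hhold.trans ?_
  rw [← ENNReal.mul_rpow_of_nonneg _ _ (by norm_num : (0 : ℝ) ≤ 1 / 2), screenedSeminorm]
  refine ENNReal.rpow_le_rpow ?_ (by norm_num)
  simp_rw [← setLIntegral_screenedKernel]
  calc _ ≤ G x * volume J := by gcongr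
    _ ≤ (∫⁻ z in J, G z) / volume J * volume J := by
        rw [setLAverage_eq] at hx; gcongr
    _ = ∫⁻ z in J, G z := ENNReal.div_mul_cancel hJ0 hJtop
    _ ≤ _ := hsub

lemma mul_enorm_sub_le_lintegral_add {K : Set ℝ} {h : ℝ → ℝ} (hh : Measurable h) (c d : ℝ) :
    volume K * ‖c - d‖ₑ ≤ (∫⁻ x in K, ‖h x - c‖ₑ) + ∫⁻ x in K, ‖h x - d‖ₑ := by
  rw [← lintegral_add_left (by fun_prop), mul_comm, ← setLIntegral_const]
  refine lintegral_mono fun x => ?_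
  rw [← enorm_neg (h x - c)]
  convert enorm_add_le (-(h x - c)) (h x - d) using 2
  ring

/-- Two local Poincaré inequalities on overlapping sets give one on the union. -/
lemma lintegral_union_sub_const_le {A B K : Set ℝ} (hKA : K ⊆ A) (hKB : K ⊆ B)
    (hK0 : volume K ≠ 0) (hKtop : volume K ≠ ⊤) {h : ℝ → ℝ} (hh : Measurable h) (c d : ℝ) :
    ∫⁻ x in A ∪ B, ‖h x - c‖ₑ ≤
      (1 + volume B / volume K) * ((∫⁻ x in A, ‖h x - c‖ₑ) + ∫⁻ x in B, ‖h x - d‖ₑ) := by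
  set P := ∫⁻ x in A, ‖h x - c‖ₑ
  set Q := ∫⁻ x in B, ‖h x - d‖ₑ
  have hcd : ‖c - d‖ₑ ≤ (P + Q) / volume K := by
    rw [ENNReal.le_div_iff_mul_le (.inl hK0) (.inl hKtop), mul_comm]
    exact (mul_enorm_sub_le_lintegral_add hh c d).trans
      (add_le_add (lintegral_mono_set hKA) (lintegral_mono_set hKB))
  have hB : ∫⁻ x in B, ‖h x - c‖ₑ ≤ Q + (P + Q) / volume K * volume B := by
    calc ∫⁻ x in B, ‖h x - c‖ₑ ≤ ∫⁻ x in B, (‖h x - d‖ₑ + ‖c - d‖ₑ) := by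
          refine lintegral_mono fun x => ?_
          rw [← enorm_neg (c - d)]
          convert enorm_add_le (h x - d) (-(c - d)) using 2
          ring
      _ = Q + ‖c - d‖ₑ * volume B := by
          rw [lintegral_add_left (by fun_prop), setLIntegral_const]
      _ ≤ _ := by gcongr
  calc ∫⁻ x in A ∪ B, ‖h x - c‖ₑ ≤ P + (Q + (P + Q) / volume K * volume B) :=
        (lintegral_union_le _ A B).trans (by gcongr)
    _ = _ := by simp only [div_eq_mul_inv]; ring

/-- Poincaré inequality for the screened seminorm on bounded intervals, up to a constant
depending on `h`. -/
lemma exists_poincare_const {E : Set ℝ} (n : ℕ) {a b : ℝ} (hab : a < b)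
    (hlen : b - a ≤ (3 / 2 : ℝ) ^ n) (hE : Ioo a b ⊆ E) :
    ∃ C : ℝ≥0∞, C ≠ ⊤ ∧ ∀ h : ℝ → ℝ, Measurable h →
      ∃ c : ℝ, ∫⁻ x in Ioo a b, ‖h x - c‖ₑ ≤ C * screenedSeminorm E 1 h := by
  induction n generalizing a b with
  | zero =>
    exact ⟨1, ENNReal.one_ne_top, fun h hh => by
      simpa using exists_const_lintegral_le_of_length_le_one hab (by simpa using hlen) hE hh⟩
  | succ n ih =>
    rw [pow_succ] at hlen
    set A := Ioo a (a + 2 * (b - a) / 3) with hA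
    set B := Ioo (a + (b - a) / 3) b with hB
    set K := Ioo (a + (b - a) / 3) (a + 2 * (b - a) / 3) with hK
    obtain ⟨C₁, hC₁, h₁⟩ := ih (a := a) (b := a + 2 * (b - a) / 3) (by linarith) (by linarith)
      ((Ioo_subset_Ioo_right (by linarith)).trans hE)
    obtain ⟨C₂, hC₂, h₂⟩ := ih (a := a + (b - a) / 3) (b := b) (by linarith) (by linarith)
      ((Ioo_subset_Ioo_left (by linarith)).trans hE)
    have hK0 : volume K ≠ 0 := by
      rw [hK, Real.volume_Ioo, ENNReal.ofReal_ne_zero_iff]; linarith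
    have hKtop : volume K ≠ ⊤ := by simp [hK]
    have hAB : Ioo a b ⊆ A ∪ B := fun x hx => by
      rcases lt_or_ge x (a + 2 * (b - a) / 3) with hlt | hge
      · exact .inl ⟨hx.1, hlt⟩
      · exact .inr ⟨by linarith, hx.2⟩
    refine ⟨(1 + volume B / volume K) * (C₁ + C₂), ?_, fun h hh => ?_⟩
    · refine ENNReal.mul_ne_top ?_ (ENNReal.add_ne_top.2 ⟨hC₁, hC₂⟩)
      exact ENNReal.add_ne_top.2 ⟨ENNReal.one_ne_top, ENNReal.div_ne_top (by simp [hB]) hK0⟩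
    · obtain ⟨c, hc⟩ := h₁ h hh
      obtain ⟨d, hd⟩ := h₂ h hh
      refine ⟨c, (lintegral_mono_set hAB).trans ((lintegral_union_sub_const_le
        (Ioo_subset_Ioo_left (by linarith)) (Ioo_subset_Ioo_right (by linarith))
        hK0 hKtop hh c d).trans ?_)⟩
      rw [mul_assoc, add_mul C₁ C₂]
      gcongr

lemma mul_enorm_avgOn_sub_le {J : Set ℝ} (hJ0 : volume J ≠ 0) (hJtop : volume J ≠ ⊤)
    {h : ℝ → ℝ} (hh : IntegrableOn h J) (c : ℝ) :
    volume J * ‖avgOn J h - c‖ₑ ≤ ∫⁻ x in J, ‖h x - c‖ₑ := by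
  have hpos : (volume J).toReal ≠ 0 := ENNReal.toReal_ne_zero.2 ⟨hJ0, hJtop⟩
  have hint : ∫ x in J, (h x - c) = (volume J).toReal * (avgOn J h - c) := by
    rw [integral_sub hh (integrableOn_const hJtop), setIntegral_const, avgOn, smul_eq_mul,
      Measure.real]
    field_simp
  calc volume J * ‖avgOn J h - c‖ₑ = ‖∫ x in J, (h x - c)‖ₑ := by
        rw [hint, enorm_mul, Real.enorm_eq_ofReal ENNReal.toReal_nonneg,
          ENNReal.ofReal_toReal hJtop]
    _ ≤ _ := enorm_integral_le_lintegral_enorm _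

/-- Poincaré inequality on a bounded interval for the deviation from the average over a
subinterval. -/
lemma exists_poincare_avgOn {E : Set ℝ} {a b p q : ℝ} (hpq : p < q)
    (hJ : Ioo p q ⊆ Ioo a b) (hE : Ioo a b ⊆ E) :
    ∃ C : ℝ≥0∞, C ≠ ⊤ ∧ ∀ h : ℝ → ℝ, Measurable h → IntegrableOn h (Ioo p q) →
      ∫⁻ x in Ioo a b, ‖h x - avgOn (Ioo p q) h‖ₑ ≤ C * screenedSeminorm E 1 h := by
  have hab : a < b := by
    obtain ⟨x, hx⟩ := (nonempty_Ioo.2 hpq).mono hJ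
    exact hx.1.trans hx.2
  obtain ⟨n, hn⟩ := pow_unbounded_of_one_lt (b - a) (by norm_num : (1 : ℝ) < 3 / 2)
  obtain ⟨C, hC, hpc⟩ := exists_poincare_const n hab hn.le hE
  set J := Ioo p q with hJdef
  have hJ0 : volume J ≠ 0 := by simp [hJdef, hpq]
  have hJtop : volume J ≠ ⊤ := by simp [hJdef]
  refine ⟨(1 + volume (Ioo a b) / volume J) * C, ?_, fun h hh hint => ?_⟩
  · exact ENNReal.mul_ne_top
      (ENNReal.add_ne_top.2 ⟨ENNReal.one_ne_top, ENNReal.div_ne_top (by simp) hJ0⟩) hC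
  · obtain ⟨c, hc⟩ := hpc h hh
    have havg : ‖avgOn J h - c‖ₑ ≤ (∫⁻ x in Ioo a b, ‖h x - c‖ₑ) / volume J := by
      rw [ENNReal.le_div_iff_mul_le (.inl hJ0) (.inl hJtop), mul_comm]
      exact (mul_enorm_avgOn_sub_le hJ0 hJtop hint c).trans (lintegral_mono_set hJ)
    rw [mul_assoc]
    calc ∫⁻ x in Ioo a b, ‖h x - avgOn J h‖ₑ
        ≤ ∫⁻ x in Ioo a b, (‖h x - c‖ₑ + ‖avgOn J h - c‖ₑ) := by
          refine lintegral_mono fun x => ?_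
          rw [← enorm_neg (avgOn J h - c)]
          convert enorm_add_le (h x - c) (-(avgOn J h - c)) using 2
          ring
      _ = (∫⁻ x in Ioo a b, ‖h x - c‖ₑ) + ‖avgOn J h - c‖ₑ * volume (Ioo a b) := by
          rw [lintegral_add_left (by fun_prop), setLIntegral_const]
      _ ≤ (∫⁻ x in Ioo a b, ‖h x - c‖ₑ) +
            (∫⁻ x in Ioo a b, ‖h x - c‖ₑ) / volume J * volume (Ioo a b) := by gcongr
      _ = (1 + volume (Ioo a b) / volume J) * ∫⁻ x in Ioo a b, ‖h x - c‖ₑ := by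
          simp only [div_eq_mul_inv]; ring
      _ ≤ _ := by gcongr

lemma LocIntOn.sub {S : Set ℝ} {f g : ℝ → ℝ} (hf : LocIntOn S f) (hg : LocIntOn S g) :
    LocIntOn S fun x => f x - g x :=
  fun s hs hm hb => (hf s hs hm hb).sub (hg s hs hm hb)

lemma locIntOn_const (S : Set ℝ) (c : ℝ) : LocIntOn S fun _ => c :=
  fun _ _ _ hb => integrableOn_const hb.measure_lt_top.ne

lemma LocIntOn.congr_ae {S : Set ℝ} {f g : ℝ → ℝ} (hf : LocIntOn S f)
    (hfg : f =ᵐ[volume.restrict S] g) : LocIntOn S g :=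
  fun s hs hm hb => (hf s hs hm hb).congr_fun_ae (ae_restrict_of_ae_restrict_of_subset hs hfg)

lemma iUnion_inter_Ioo_natCast (S : Set ℝ) : ⋃ R : ℕ, S ∩ Ioo (-(R : ℝ)) R = S := by
  refine subset_antisymm (iUnion_subset fun _ => inter_subset_left) fun x hx => ?_
  obtain ⟨n, hn⟩ := exists_nat_gt |x|
  exact mem_iUnion.2 ⟨n, hx, abs_lt.1 hn⟩

lemma LocIntOn.aemeasurable {S : Set ℝ} (hS : MeasurableSet S) {f : ℝ → ℝ}
    (hf : LocIntOn S f) : AEMeasurable f (volume.restrict S) := by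
  rw [← iUnion_inter_Ioo_natCast S, aemeasurable_iUnion_iff]
  exact fun R => (hf _ inter_subset_left (hS.inter measurableSet_Ioo)
    (Metric.isBounded_Ioo _ _ |>.subset inter_subset_right)).aemeasurable

lemma avgOn_sub {J : Set ℝ} {f g : ℝ → ℝ} (hf : IntegrableOn f J) (hg : IntegrableOn g J) :
    avgOn J (fun x => f x - g x) = avgOn J f - avgOn J g := by
  rw [avgOn, integral_sub hf hg, mul_sub]
  rfl

lemma avgOn_const {J : Set ℝ} (hJ0 : volume J ≠ 0) (hJtop : volume J ≠ ⊤) (c : ℝ) :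
    avgOn J (fun _ => c) = c := by
  have hpos : (volume J).toReal ≠ 0 := ENNReal.toReal_ne_zero.2 ⟨hJ0, hJtop⟩
  rw [avgOn, setIntegral_const, smul_eq_mul, Measure.real]
  field_simp

lemma avgOn_congr_ae {J : Set ℝ} {f g : ℝ → ℝ} (hfg : f =ᵐ[volume.restrict J] g) :
    avgOn J f = avgOn J g := by
  rw [avgOn, avgOn, integral_congr_ae hfg]

namespace GammaConfig

variable {N : ℕ} (cfg : GammaConfig N)

lemma measurableSet_E (j : Fin (N + 1)) : MeasurableSet (cfg.E j) := by
  rcases cfg.hE j with ⟨a, b, -, h⟩ | ⟨-, b, h⟩ | ⟨-, a, h⟩ <;> rw [h]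
  exacts [measurableSet_Ioo, measurableSet_Iio, measurableSet_Ioi]

lemma measurableSet_Gamma : MeasurableSet cfg.Gamma :=
  MeasurableSet.iUnion cfg.measurableSet_E

lemma E_subset_Gamma (j : Fin (N + 1)) : cfg.E j ⊆ cfg.Gamma := subset_iUnion cfg.E j

lemma I_subset_Gamma (j : Fin (N + 1)) : cfg.I j ⊆ cfg.Gamma :=
  (cfg.hIsub j).trans (cfg.E_subset_Gamma j)

lemma isBounded_I (j : Fin (N + 1)) : Bornology.IsBounded (cfg.I j) := by
  obtain ⟨p, q, -, h⟩ := cfg.hIint j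
  rw [h]
  exact Metric.isBounded_Ioo p q

lemma volume_I_ne_top (j : Fin (N + 1)) : volume (cfg.I j) ≠ ⊤ :=
  (cfg.isBounded_I j).measure_lt_top.ne

lemma volume_I_ne_zero (j : Fin (N + 1)) : volume (cfg.I j) ≠ 0 := by
  obtain ⟨p, q, hpq, h⟩ := cfg.hIint j
  simp [h, hpq]

lemma integrableOn_I {h : ℝ → ℝ} (hh : LocIntOn cfg.Gamma h) (j : Fin (N + 1)) :
    IntegrableOn h (cfg.I j) := by
  refine hh _ (cfg.I_subset_Gamma j) ?_ (cfg.isBounded_I j)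
  obtain ⟨p, q, -, h⟩ := cfg.hIint j
  rw [h]
  exact measurableSet_Ioo

lemma screenedSeminorm_le_seminorm (h : ℝ → ℝ) (j : Fin (N + 1)) :
    screenedSeminorm (cfg.E j) 1 h ≤ cfg.seminorm h :=
  (Finset.single_le_sum (f := fun j => screenedSeminorm (cfg.E j) 1 h)
    (fun _ _ => zero_le) (Finset.mem_univ j)).trans le_self_add

lemma ofReal_abs_avgOn_sub_le_seminorm (h : ℝ → ℝ) (j : Fin N) :
    ENNReal.ofReal |avgOn (cfg.I j.succ) h - avgOn (cfg.I j.castSucc) h| ≤ cfg.seminorm h :=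
  (Finset.single_le_sum
    (f := fun j : Fin N =>
      ENNReal.ofReal |avgOn (cfg.I j.succ) h - avgOn (cfg.I j.castSucc) h|)
    (fun _ _ => zero_le) (Finset.mem_univ j)).trans le_add_self

lemma enorm_avgOn_sub_avgOn_zero_le (h : ℝ → ℝ) (j : Fin (N + 1)) :
    ‖avgOn (cfg.I j) h - avgOn (cfg.I 0) h‖ₑ ≤ (j : ℕ) * cfg.seminorm h := by
  induction j using Fin.induction with
  | zero => simp
  | succ j ih =>
    have hstep := cfg.ofReal_abs_avgOn_sub_le_seminorm h j
    rw [← Real.norm_eq_abs, ofReal_norm] at hstep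
    rw [← sub_add_sub_cancel _ (avgOn (cfg.I j.castSucc) h)]
    refine (enorm_add_le _ _).trans ((add_le_add hstep ih).trans_eq ?_)
    rw [Fin.val_succ, Fin.val_castSucc, Nat.cast_succ, add_mul, one_mul, add_comm]

lemma exists_Ioo_between (j : Fin (N + 1)) (R : ℝ) :
    ∃ a b : ℝ, cfg.E j ∩ Ioo (-R) R ⊆ Ioo a b ∧ cfg.I j ⊆ Ioo a b ∧ Ioo a b ⊆ cfg.E j := by
  have hI := cfg.hIsub j
  obtain ⟨p, q, -, hpq⟩ := cfg.hIint j
  rcases cfg.hE j with ⟨a, b, -, h⟩ | ⟨-, b, h⟩ | ⟨-, a, h⟩ <;> rw [h] at hI ⊢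
  · exact ⟨a, b, inter_subset_left, hI, subset_rfl⟩
  · refine ⟨min (-R) p, b, fun x hx => ⟨min_lt_of_left_lt hx.2.1, hx.1⟩, fun x hx => ?_,
      Ioo_subset_Iio_self⟩
    exact ⟨min_lt_of_right_lt (hpq ▸ hx : x ∈ Ioo p q).1, hI hx⟩
  · refine ⟨a, max R q, fun x hx => ⟨hx.1, lt_max_of_lt_left hx.2.2⟩, fun x hx => ?_,
      Ioo_subset_Ioi_self⟩
    exact ⟨hI hx, lt_max_of_lt_right (hpq ▸ hx : x ∈ Ioo p q).2⟩

/-- Poincaré inequality on bounded parts of `Γ^D` for the deviation from the average over the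
first window. -/
lemma exists_poincare (R : ℝ) :
    ∃ C : ℝ≥0∞, C ≠ ⊤ ∧ ∀ h : ℝ → ℝ, Measurable h → LocIntOn cfg.Gamma h →
      ∫⁻ x in cfg.Gamma ∩ Ioo (-R) R, ‖h x - avgOn (cfg.I 0) h‖ₑ ≤ C * cfg.seminorm h := by
  have hlocal : ∀ j, ∃ C : ℝ≥0∞, C ≠ ⊤ ∧ ∀ h : ℝ → ℝ, Measurable h → LocIntOn cfg.Gamma h →
      ∫⁻ x in cfg.E j ∩ Ioo (-R) R, ‖h x - avgOn (cfg.I 0) h‖ₑ ≤ C * cfg.seminorm h := by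
    intro j
    obtain ⟨a, b, hR, hI, hE⟩ := cfg.exists_Ioo_between j R
    obtain ⟨p, q, hpq, hIpq⟩ := cfg.hIint j
    obtain ⟨C, hC, hpc⟩ := exists_poincare_avgOn hpq (hIpq ▸ hI) hE
    rw [← hIpq] at hpc
    refine ⟨C + (j : ℕ) * volume (Ioo a b), ?_, fun h hh hloc => ?_⟩
    · exact ENNReal.add_ne_top.2 ⟨hC, ENNReal.mul_ne_top (ENNReal.natCast_ne_top _) (by simp)⟩
    · calc ∫⁻ x in cfg.E j ∩ Ioo (-R) R, ‖h x - avgOn (cfg.I 0) h‖ₑ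
          ≤ ∫⁻ x in Ioo a b, ‖h x - avgOn (cfg.I 0) h‖ₑ := lintegral_mono_set hR
        _ ≤ ∫⁻ x in Ioo a b, (‖h x - avgOn (cfg.I j) h‖ₑ +
              ‖avgOn (cfg.I j) h - avgOn (cfg.I 0) h‖ₑ) := by
            refine lintegral_mono fun x => ?_
            rw [← sub_add_sub_cancel (h x) (avgOn (cfg.I j) h)]
            exact enorm_add_le _ _
        _ = (∫⁻ x in Ioo a b, ‖h x - avgOn (cfg.I j) h‖ₑ) +
              ‖avgOn (cfg.I j) h - avgOn (cfg.I 0) h‖ₑ * volume (Ioo a b) := by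
            rw [lintegral_add_left (by fun_prop), setLIntegral_const]
        _ ≤ C * cfg.seminorm h + (j : ℕ) * cfg.seminorm h * volume (Ioo a b) := by
            gcongr
            · exact (hpc h hh (cfg.integrableOn_I hloc j)).trans
                (mul_le_mul_right (cfg.screenedSeminorm_le_seminorm h j) C)
            · exact cfg.enorm_avgOn_sub_avgOn_zero_le h j
        _ = _ := by ring
  choose C hC hpc using hlocal
  refine ⟨∑ j, C j, ENNReal.sum_ne_top.2 fun j _ => hC j, fun h hh hloc => ?_⟩
  rw [Gamma, iUnion_inter, Finset.sum_mul]
  refine (lintegral_iUnion_le _ _).trans ?_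
  rw [tsum_fintype]
  exact Finset.sum_le_sum fun j _ => hpc j h hh hloc

lemma seminorm_congr_ae {f g : ℝ → ℝ} (hfg : f =ᵐ[volume.restrict cfg.Gamma] g) :
    cfg.seminorm f = cfg.seminorm g := by
  have hE : ∀ j, screenedSeminorm (cfg.E j) 1 f = screenedSeminorm (cfg.E j) 1 g := fun j =>
    screenedSeminorm_congr_ae (ae_restrict_of_ae_restrict_of_subset (cfg.E_subset_Gamma j) hfg)
  have hI : ∀ j, avgOn (cfg.I j) f = avgOn (cfg.I j) g := fun j =>
    avgOn_congr_ae (ae_restrict_of_ae_restrict_of_subset (cfg.I_subset_Gamma j) hfg)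
  simp only [seminorm, hE, hI]

lemma seminorm_lt_top_of_sub {f g : ℝ → ℝ} (hf : Measurable f) (hg : Measurable g)
    (hf' : cfg.seminorm f < ⊤) (hfg : cfg.seminorm (fun x => f x - g x) < ⊤) :
    cfg.seminorm g < ⊤ := by
  refine ENNReal.add_lt_top.2 ⟨ENNReal.sum_lt_top.2 fun j _ => ?_,
    ENNReal.sum_lt_top.2 fun j _ => ENNReal.ofReal_lt_top⟩
  exact screenedSeminorm_lt_top_of_sub hf hg
    ((cfg.screenedSeminorm_le_seminorm f j).trans_lt hf')
    ((cfg.screenedSeminorm_le_seminorm _ j).trans_lt hfg)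

/-- `f` with its average over the first window subtracted. -/
noncomputable def normalize (f : ℝ → ℝ) : ℝ → ℝ := fun x => f x - avgOn (cfg.I 0) f

lemma measurable_normalize {f : ℝ → ℝ} (hf : Measurable f) : Measurable (cfg.normalize f) :=
  hf.sub_const _

lemma locIntOn_normalize {f : ℝ → ℝ} (hf : LocIntOn cfg.Gamma f) :
    LocIntOn cfg.Gamma (cfg.normalize f) :=
  hf.sub (locIntOn_const _ _)

lemma normalize_sub_normalize {f g : ℝ → ℝ} (hf : LocIntOn cfg.Gamma f)
    (hg : LocIntOn cfg.Gamma g) (x : ℝ) :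
    cfg.normalize f x - cfg.normalize g x =
      f x - g x - avgOn (cfg.I 0) (fun y => f y - g y) := by
  rw [avgOn_sub (cfg.integrableOn_I hf 0) (cfg.integrableOn_I hg 0), normalize, normalize]
  ring

lemma avgOn_I_normalize {f : ℝ → ℝ} (hf : LocIntOn cfg.Gamma f) (j : Fin (N + 1)) :
    avgOn (cfg.I j) (cfg.normalize f) = avgOn (cfg.I j) f - avgOn (cfg.I 0) f := by
  unfold normalize
  rw [avgOn_sub (cfg.integrableOn_I hf j) (cfg.integrableOn_I (locIntOn_const _ _) j),
    avgOn_const (cfg.volume_I_ne_zero j) (cfg.volume_I_ne_top j)]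

/-- A sequence whose consecutive seminorm distances are summable converges almost everywhere on
`Γ^D` after normalization. -/
lemma exists_tendsto_ae_normalize {w : ℕ → ℝ → ℝ} (hw : ∀ n, Measurable (w n))
    (hloc : ∀ n, LocIntOn cfg.Gamma (w n))
    (hsum : ∑' k, cfg.seminorm (fun x => w (k + 1) x - w k x) ≠ ⊤) :
    ∃ g : ℝ → ℝ, Measurable g ∧ ∀ᵐ x ∂volume.restrict cfg.Gamma,
      Tendsto (fun k => cfg.normalize (w k) x) atTop (nhds (g x)) := by
  refine measurable_limit_of_tendsto_metrizable_ae
    (fun n => (cfg.measurable_normalize (hw n)).aemeasurable) ?_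
  rw [← iUnion_inter_Ioo_natCast cfg.Gamma, ae_restrict_iUnion_iff]
  intro R
  obtain ⟨C, hC, hpc⟩ := cfg.exists_poincare R
  have hmeas : ∀ k, Measurable fun x =>
      ‖cfg.normalize (w (k + 1)) x - cfg.normalize (w k) x‖ₑ := fun k =>
    ((cfg.measurable_normalize (hw _)).sub (cfg.measurable_normalize (hw _))).enorm
  have hint : ∫⁻ x in cfg.Gamma ∩ Ioo (-(R : ℝ)) R,
      ∑' k, ‖cfg.normalize (w (k + 1)) x - cfg.normalize (w k) x‖ₑ ≠ ⊤ := by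
    rw [lintegral_tsum fun k => (hmeas k).aemeasurable]
    refine ne_top_of_le_ne_top (ENNReal.mul_ne_top hC hsum) ?_
    rw [← ENNReal.tsum_mul_left]
    refine ENNReal.tsum_le_tsum fun k => ?_
    simp_rw [cfg.normalize_sub_normalize (hloc (k + 1)) (hloc k)]
    exact hpc _ ((hw _).sub (hw _)) ((hloc _).sub (hloc _))
  filter_upwards [ae_lt_top (.tsum hmeas) hint] with x hx
  refine cauchySeq_tendsto_of_complete (cauchySeq_of_edist_le_of_tsum_ne_top _ (fun k => ?_) hx.ne)
  rw [edist_comm, edist_eq_enorm_sub]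

/-- Quantitative local `L¹` convergence of normalized functions. -/
lemma lintegral_normalize_sub_le {R : ℝ} {C : ℝ≥0∞}
    (hpc : ∀ h : ℝ → ℝ, Measurable h → LocIntOn cfg.Gamma h →
      ∫⁻ x in cfg.Gamma ∩ Ioo (-R) R, ‖h x - avgOn (cfg.I 0) h‖ₑ ≤ C * cfg.seminorm h)
    {f : ℝ → ℝ} {w : ℕ → ℝ → ℝ} {g : ℝ → ℝ} (hf : Measurable f) (hw : ∀ n, Measurable (w n))
    (hfloc : LocIntOn cfg.Gamma f) (hloc : ∀ n, LocIntOn cfg.Gamma (w n))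
    (hlim : ∀ᵐ x ∂volume.restrict cfg.Gamma,
      Tendsto (fun k => cfg.normalize (w k) x) atTop (nhds (g x)))
    {ε : ℝ≥0∞} (hε : ∀ᶠ k in atTop, cfg.seminorm (fun x => f x - w k x) ≤ ε) :
    ∫⁻ x in cfg.Gamma ∩ Ioo (-R) R, ‖cfg.normalize f x - g x‖ₑ ≤ C * ε := by
  set S := cfg.Gamma ∩ Ioo (-R) R
  calc ∫⁻ x in S, ‖cfg.normalize f x - g x‖ₑ
      = ∫⁻ x in S, liminf (fun k => ‖cfg.normalize f x - cfg.normalize (w k) x‖ₑ) atTop := by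
        refine lintegral_congr_ae ?_
        filter_upwards [ae_restrict_of_ae_restrict_of_subset inter_subset_left hlim] with x hx
        exact (tendsto_const_nhds.sub hx).enorm.liminf_eq.symm
    _ ≤ liminf (fun k => ∫⁻ x in S, ‖cfg.normalize f x - cfg.normalize (w k) x‖ₑ) atTop :=
        lintegral_liminf_le fun k =>
          ((cfg.measurable_normalize hf).sub (cfg.measurable_normalize (hw k))).enorm
    _ ≤ C * ε := by
        refine liminf_le_of_frequently_le' (hε.mono fun k hk => ?_).frequently
        simp_rw [cfg.normalize_sub_normalize hfloc (hloc k)]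
        exact (hpc _ (hf.sub (hw k)) (hfloc.sub (hloc k))).trans (mul_le_mul_right hk C)

lemma tendsto_seminorm_of_tendsto {h : ℕ → ℝ → ℝ}
    (hE : ∀ j, Tendsto (fun n => screenedSeminorm (cfg.E j) 1 (h n)) atTop (nhds 0))
    (hI : ∀ j : Fin N, Tendsto (fun n => ENNReal.ofReal
      |avgOn (cfg.I j.succ) (h n) - avgOn (cfg.I j.castSucc) (h n)|) atTop (nhds 0)) :
    Tendsto (fun n => cfg.seminorm (h n)) atTop (nhds 0) := by
  simpa [seminorm] using
    (tendsto_finsetSum Finset.univ fun j _ => hE j).add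
      (tendsto_finsetSum Finset.univ fun j _ => hI j)

/-- Completeness of `Ḣ^{1/2}(Γ^D)` for sequences of everywhere measurable functions. -/
lemma exists_tendsto_seminorm {f : ℕ → ℝ → ℝ} (hmeas : ∀ n, Measurable (f n))
    (hloc : ∀ n, LocIntOn cfg.Gamma (f n)) (hfin : ∀ n, cfg.seminorm (f n) < ⊤)
    (hcauchy : Tendsto (fun p : ℕ × ℕ => cfg.seminorm (fun x => f p.1 x - f p.2 x))
      atTop (nhds 0)) :
    ∃ g : ℝ → ℝ, LocIntOn cfg.Gamma g ∧ cfg.seminorm g < ⊤ ∧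
      Tendsto (fun n => cfg.seminorm (fun x => f n x - g x)) atTop (nhds 0) := by
  obtain ⟨φ, hφ, hφs⟩ : ∃ φ : ℕ → ℕ, StrictMono φ ∧ ∀ k, ∀ n ≥ φ k, ∀ m ≥ φ k,
      cfg.seminorm (fun x => f n x - f m x) ≤ 2⁻¹ ^ k := by
    refine extraction_forall_of_eventually' (P := fun k a => ∀ n ≥ a, ∀ m ≥ a,
      cfg.seminorm (fun x => f n x - f m x) ≤ 2⁻¹ ^ k) fun k => ?_
    obtain ⟨⟨a, b⟩, hab⟩ := ENNReal.tendsto_atTop_zero.1 hcauchy (2⁻¹ ^ k)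
      (ENNReal.pow_pos (by simp) k)
    exact ⟨max a b, fun l hl n hn m hm => hab (n, m)
      ⟨(le_max_left a b).trans (hl.trans hn), (le_max_right a b).trans (hl.trans hm)⟩⟩
  have hw : ∀ k, Measurable (f (φ k)) := fun k => hmeas _
  have hwloc : ∀ k, LocIntOn cfg.Gamma (f (φ k)) := fun k => hloc _
  have hsum : ∑' k, cfg.seminorm (fun x => f (φ (k + 1)) x - f (φ k) x) ≠ ⊤ := by
    refine ne_top_of_le_ne_top ?_ (ENNReal.tsum_le_tsum fun k =>
      hφs k _ (hφ.monotone k.le_succ) _ le_rfl)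
    simp [ENNReal.tsum_geometric]
  obtain ⟨g, hg, hlim⟩ := cfg.exists_tendsto_ae_normalize hw hwloc hsum
  have hsmall : ∀ k n, φ k ≤ n →
      ∀ᶠ l in atTop, cfg.seminorm (fun x => f n x - f (φ l) x) ≤ 2⁻¹ ^ k := fun k n hn =>
    (eventually_ge_atTop k).mono fun l hl => hφs k n hn _ (hφ.monotone hl)
  have hL1 : ∀ s ⊆ cfg.Gamma, Bornology.IsBounded s → ∃ C : ℝ≥0∞, C ≠ ⊤ ∧
      ∀ k, ∫⁻ x in s, ‖cfg.normalize (f (φ k)) x - g x‖ₑ ≤ C * 2⁻¹ ^ k := by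
    intro s hs hb
    obtain ⟨R, hR⟩ := hb.subset_ball 0
    rw [Real.ball_eq_Ioo, zero_sub, zero_add] at hR
    obtain ⟨C, hC, hpc⟩ := cfg.exists_poincare R
    exact ⟨C, hC, fun k => (lintegral_mono_set (subset_inter hs hR)).trans
      (cfg.lintegral_normalize_sub_le hpc (hw k) hw (hwloc k) hwloc hlim
        (hsmall k _ le_rfl))⟩
  have hgloc : LocIntOn cfg.Gamma g := by
    intro s hs hm hb
    obtain ⟨C, hC, hs'⟩ := hL1 s hs hb
    have hd : IntegrableOn (fun x => cfg.normalize (f (φ 0)) x - g x) s :=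
      ⟨((cfg.measurable_normalize (hw 0)).sub hg).aestronglyMeasurable,
        (hs' 0).trans_lt (by simpa using hC.lt_top)⟩
    have hsub := (cfg.locIntOn_normalize (hwloc 0) s hs hm hb).sub hd
    refine hsub.congr (ae_of_all _ fun x => ?_)
    simp
  have havg : ∀ j, Tendsto (fun k => avgOn (cfg.I j) (cfg.normalize (f (φ k)))) atTop
      (nhds (avgOn (cfg.I j) g)) := by
    intro j
    obtain ⟨C, hC, hs⟩ := hL1 _ (cfg.I_subset_Gamma j) (cfg.isBounded_I j)
    refine (tendsto_integral_of_L1 g hg.aestronglyMeasurable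
      (.of_forall fun k => cfg.integrableOn_I (cfg.locIntOn_normalize (hwloc k)) j)
      (tendsto_of_tendsto_of_tendsto_of_le_of_le tendsto_const_nhds ?_
        (fun _ => zero_le) hs)).const_mul _
    simpa using ENNReal.Tendsto.const_mul
      (ENNReal.tendsto_pow_atTop_nhds_zero_of_lt_one (r := 2⁻¹) (by simp)) (.inr hC)
  have htends : ∀ t : ℕ → ℝ≥0∞, (∀ k n, φ k ≤ n → t n ≤ 2⁻¹ ^ k) →
      Tendsto t atTop (nhds 0) := by
    intro t ht
    refine ENNReal.tendsto_atTop_zero.2 fun ε hε => ?_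
    obtain ⟨k, hk⟩ := ENNReal.exists_inv_two_pow_lt hε.ne'
    exact ⟨φ k, fun n hn => (ht k n hn).trans hk.le⟩
  have hconv : Tendsto (fun n => cfg.seminorm (fun x => f n x - g x)) atTop (nhds 0) := by
    refine cfg.tendsto_seminorm_of_tendsto (fun j => htends _ fun k n hn => ?_)
      (fun j => htends _ fun k n hn => ?_)
    · refine screenedSeminorm_le_of_tendsto_ae
        (h := fun l x => f n x - cfg.normalize (f (φ l)) x)
        (fun l => (hmeas n).sub (cfg.measurable_normalize (hw l))) ((hmeas n).sub hg) ?_ ?_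
      · filter_upwards [ae_restrict_of_ae_restrict_of_subset (cfg.E_subset_Gamma j) hlim]
          with x hx
        exact tendsto_const_nhds.sub hx
      · filter_upwards [hsmall k n hn] with l hl
        refine le_trans (le_of_eq ?_) ((cfg.screenedSeminorm_le_seminorm _ j).trans hl)
        rw [← screenedSeminorm_sub_const (cfg.E j) 1 (fun x => f n x - f (φ l) x)
          (-avgOn (cfg.I 0) (f (φ l)))]
        congr 1
        ext x
        rw [normalize]
        ring
    · have hsub : ∀ i, avgOn (cfg.I i) (fun x => f n x - g x) =
          avgOn (cfg.I i) (f n) - avgOn (cfg.I i) g := fun i =>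
        avgOn_sub (cfg.integrableOn_I (hloc n) i) (cfg.integrableOn_I hgloc i)
      rw [hsub, hsub]
      have hlim' := ENNReal.tendsto_ofReal
        (((tendsto_const_nhds (x := avgOn (cfg.I j.succ) (f n))).sub (havg j.succ)).sub
          ((tendsto_const_nhds (x := avgOn (cfg.I j.castSucc) (f n))).sub
            (havg j.castSucc))).abs
      refine le_of_tendsto hlim' ?_
      filter_upwards [hsmall k n hn] with l hl
      refine le_trans (le_of_eq ?_) ((cfg.ofReal_abs_avgOn_sub_le_seminorm _ j).trans hl)
      rw [cfg.avgOn_I_normalize (hwloc l), cfg.avgOn_I_normalize (hwloc l),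
        avgOn_sub (cfg.integrableOn_I (hloc n) _) (cfg.integrableOn_I (hwloc l) _),
        avgOn_sub (cfg.integrableOn_I (hloc n) _) (cfg.integrableOn_I (hwloc l) _)]
      congr 2
      ring
  obtain ⟨n, hn⟩ := (hconv.eventually (gt_mem_nhds ENNReal.zero_lt_top)).exists
  exact ⟨g, hgloc, cfg.seminorm_lt_top_of_sub (hmeas n) hg (hfin n) hn, hconv⟩

end GammaConfig

/-- completeness of `Ḣ^{1/2}(Γ^D)` modulo constants: every sequence of
locally integrable functions on `Γ^D` with finite seminorm that is Cauchy for the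
seminorm `|·|_{Ḣ^{1/2}(Γ^D)}` converges, for that seminorm, to some locally integrable
function on `Γ^D` with finite seminorm. -/
theorem statement19 {N : ℕ} (cfg : GammaConfig N) (f : ℕ → ℝ → ℝ)
    (hloc : ∀ n, LocIntOn cfg.Gamma (f n))
    (hfin : ∀ n, cfg.seminorm (f n) < ⊤)
    (hcauchy : Filter.Tendsto
      (fun p : ℕ × ℕ => cfg.seminorm (fun x => f p.1 x - f p.2 x))
      Filter.atTop (nhds 0)) :
    ∃ g : ℝ → ℝ, LocIntOn cfg.Gamma g ∧ cfg.seminorm g < ⊤ ∧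
      Filter.Tendsto (fun n => cfg.seminorm (fun x => f n x - g x))
        Filter.atTop (nhds 0) := by
  have hae : ∀ n, AEMeasurable (f n) (volume.restrict cfg.Gamma) := fun n =>
    (hloc n).aemeasurable cfg.measurableSet_Gamma
  have hmk : ∀ n, f n =ᵐ[volume.restrict cfg.Gamma] (hae n).mk := fun n => (hae n).ae_eq_mk
  have hdiff : ∀ n m, cfg.seminorm (fun x => f n x - f m x) =
      cfg.seminorm (fun x => (hae n).mk (f n) x - (hae m).mk (f m) x) := fun n m =>
    cfg.seminorm_congr_ae ((hmk n).sub (hmk m))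
  simp_rw [hdiff] at hcauchy
  obtain ⟨g, hg, hgfin, hlim⟩ := cfg.exists_tendsto_seminorm
    (fun n => (hae n).measurable_mk) (fun n => (hloc n).congr_ae (hmk n))
    (fun n => cfg.seminorm_congr_ae (hmk n) ▸ hfin n) hcauchy
  refine ⟨g, hg, hgfin, hlim.congr fun n => ?_⟩
  exact (cfg.seminorm_congr_ae ((hmk n).sub (EventuallyEq.refl _ g))).symm
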